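/- Let t0 < T, θ ∈ (0,1), 0 < μ < 1, γ > 0, b > 0, λ = −θ/(1−θ), and let η : [t0,T] → ℝ be continuously differentiable. Then for every t ∈ [t0,T], (I^{θ,μ,γ}(D^{θ,μ,γ}η))(t) = η(t) − η(t0), i.e., the generalized AB fractional integral of the generalized ABC fractional derivative of η recovers η up to its initial value. -/

import Mathlib

open Real MeasureTheory Set

/-- Generalized binomial coefficient `C(γ, i) = γ(γ-1)⋯(γ-i+1)/i!`. -/
noncomputable def genBinom (γ : ℝ) (i : ℕ) : ℝ :=
  (∏ j ∈ Finset.range i, (γ - j)) / (Nat.factorial i : ℝ)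

/-- Rising factorial `(ρ)_k = ρ(ρ+1)⋯(ρ+k-1)`. -/
noncomputable def risingFac (ρ : ℝ) (k : ℕ) : ℝ :=
  ∏ j ∈ Finset.range k, (ρ + j)

/-- Generalized Mittag-Leffler function `E_{θ,β}^ρ(λ, z)`
(terms with `Γ` at a pole vanish since `Real.Gamma` is `0` there). -/
noncomputable def mittagLeffler (θ β ρ lam z : ℝ) : ℝ :=
  ∑' k : ℕ, lam ^ k * z ^ ((k : ℝ) * θ + β - 1) * risingFac ρ k /
    (Real.Gamma ((k : ℝ) * θ + β) * (Nat.factorial k : ℝ))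

/-- Generalized AB fractional integral `(I^{θ,μ,γ} η)(t)` starting at `t0`,
with normalization constant `b = B(θ) > 0`. -/
noncomputable def ABIntegral (t0 b θ μ γ : ℝ) (η : ℝ → ℝ) (t : ℝ) : ℝ :=
  ∑' i : ℕ, genBinom γ i * θ ^ i /
      (b * (1 - θ) ^ ((i : ℝ) - 1) * Real.Gamma ((i : ℝ) * θ + 1 - μ)) *
    ∫ s in t0..t, (t - s) ^ ((i : ℝ) * θ - μ) * η s

/-- Generalized ABC fractional derivative `(D^{θ,μ,γ} f)(t)` starting at `t0`,
with `λ = -θ/(1-θ)` and normalization constant `b = B(θ) > 0`. -/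
noncomputable def ABCDeriv (t0 b θ μ γ : ℝ) (f : ℝ → ℝ) (t : ℝ) : ℝ :=
  (b / (1 - θ)) * ∫ s in t0..t, mittagLeffler θ μ γ (-θ / (1 - θ)) (t - s) * deriv f s

/-- Generalized ABR fractional derivative `(R^{θ,μ,γ} f)(t)` starting at `t0`. -/
noncomputable def ABRDeriv (t0 b θ μ γ : ℝ) (f : ℝ → ℝ) (t : ℝ) : ℝ :=
  (b / (1 - θ)) *
    deriv (fun u => ∫ s in t0..u, mittagLeffler θ μ γ (-θ / (1 - θ)) (u - s) * f s) t

/-- The contraction constant `C1(T, A)` (case `μ ≠ 1`). -/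
noncomputable def C1const (t0 T b θ μ γ A : ℝ) : ℝ :=
  (A / b) * ∑' i : ℕ, |genBinom γ i| * θ ^ i * (T - t0) ^ ((i : ℝ) * θ + 1 - μ) /
    ((1 - θ) ^ ((i : ℝ) - 1) * Real.Gamma ((i : ℝ) * θ + 2 - μ))

/-- The contraction constant `C2(T, A)` (case `μ = 1`). -/
noncomputable def C2const (t0 T b θ γ A : ℝ) : ℝ :=
  (A / b) * ((1 - θ) +
    ∑' i : ℕ, |genBinom γ (i + 1)| * θ ^ (i + 1) * (T - t0) ^ (((i : ℝ) + 1) * θ) /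
      ((1 - θ) ^ (i : ℕ) * Real.Gamma (((i : ℝ) + 1) * θ + 1)))

/-- The operator `Υ` in the case `μ = 1`, whose `i = 0` term reduces to `((1-θ)/b) f(t, x(t))`. -/
noncomputable def UpsilonMuOne (t0 b θ γ x0 : ℝ) (f : ℝ → ℝ → ℝ) (x : ℝ → ℝ) (t : ℝ) : ℝ :=
  x0 + ((1 - θ) / b) * f t (x t) +
    ∑' i : ℕ, genBinom γ (i + 1) * θ ^ (i + 1) /
        (b * (1 - θ) ^ (i : ℕ) * Real.Gamma (((i : ℝ) + 1) * θ)) *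
      ∫ s in t0..t, (t - s) ^ (((i : ℝ) + 1) * θ - 1) * f s (x s)

/-- The unnormalized Riemann–Liouville integral of order `a` with base point `t₀`. -/
noncomputable def rlIntegral (t₀ a : ℝ) (g : ℝ → ℝ) (u : ℝ) : ℝ :=
  ∫ s in t₀..u, (u - s) ^ (a - 1) * g s

lemma genBinom_eq_choose (r : ℝ) (n : ℕ) : genBinom r n = Ring.choose r n := by
  rw [Ring.choose_eq_smul, ← Polynomial.aeval_eq_smeval, Polynomial.aeval_def, ← Polynomial.eval_map,
    algebraMap_int_eq, descPochhammer_map, genBinom, descPochhammer_eval_eq_prod_range, smul_eq_mul, div_eq_inv_mul]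

lemma risingFac_div_factorial (ρ : ℝ) (k : ℕ) :
    risingFac ρ k / (k.factorial : ℝ) = (-1) ^ k * genBinom (-ρ) k := by
  have h : risingFac ρ k = (-1) ^ k * ∏ j ∈ Finset.range k, (-ρ - j) := by
    rw [risingFac, ← Finset.card_range k, ← Finset.prod_const, Finset.card_range,
      ← Finset.prod_mul_distrib]
    exact Finset.prod_congr rfl fun j _ => by ring
  rw [h, genBinom, mul_div_assoc]

lemma sum_antidiagonal_genBinom_mul_neg (r : ℝ) (n : ℕ) :
    ∑ ij ∈ Finset.HasAntidiagonal.antidiagonal n, genBinom r ij.1 * genBinom (-r) ij.2 =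
      if n = 0 then 1 else 0 := by
  simp_rw [genBinom_eq_choose]
  rw [← Ring.add_choose_eq n (Commute.all r (-r)), add_neg_cancel, Ring.choose_zero_ite]

lemma abs_genBinom_le (r : ℝ) (n : ℕ) : |genBinom r n| ≤ (|r| + 1) ^ n := by
  induction n with
  | zero => simp [genBinom]
  | succ n ih =>
    have h : genBinom r (n + 1) = genBinom r n * ((r - n) / (n + 1)) := by
      rw [genBinom, genBinom, Finset.prod_range_succ, Nat.factorial_succ]
      push_cast
      field_simp
    have h2 : |(r - n) / ((n : ℝ) + 1)| ≤ |r| + 1 := by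
      have hn : (0 : ℝ) < (n : ℝ) + 1 := by positivity
      rw [abs_div, abs_of_pos hn, div_le_iff₀ hn]
      have h3 := abs_sub r n
      rw [abs_of_nonneg (Nat.cast_nonneg n : (0 : ℝ) ≤ n)] at h3
      nlinarith [abs_nonneg r, (Nat.cast_nonneg n : (0 : ℝ) ≤ n),
        mul_nonneg (abs_nonneg r) (Nat.cast_nonneg n : (0 : ℝ) ≤ n)]
    rw [h, abs_mul, pow_succ]
    gcongr

lemma rpow_mul_exp_neg_le_Gamma {x B : ℝ} (hx : 1 ≤ x) (hB : 0 < B) :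
    B ^ (x - 1) * Real.exp (-B) ≤ Real.Gamma x := by
  rw [Real.Gamma_eq_integral (by linarith)]
  have h1 : ∫ y in Ioi B, B ^ (x - 1) * Real.exp (-y) = B ^ (x - 1) * Real.exp (-B) := by
    rw [integral_const_mul, integral_exp_neg_Ioi]
  have hint := Real.GammaIntegral_convergent (s := x) (by linarith)
  rw [← h1]
  calc ∫ y in Ioi B, B ^ (x - 1) * Real.exp (-y)
      ≤ ∫ y in Ioi B, Real.exp (-y) * y ^ (x - 1) := by
        refine setIntegral_mono_on ?_ (hint.mono_set (Ioi_subset_Ioi hB.le)) measurableSet_Ioi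
          fun y hy => ?_
        · exact (integrableOn_exp_neg_Ioi B).const_mul _
        · rw [mul_comm]
          have : B ≤ y := le_of_lt hy
          have h0 : 0 ≤ x - 1 := by linarith
          gcongr
    _ ≤ _ := by
        refine setIntegral_mono_set hint ?_ (Ioi_subset_Ioi hB.le).eventuallyLE
        filter_upwards [ae_restrict_mem measurableSet_Ioi] with y hy
        have : 0 < y := hy
        simp only [Pi.zero_apply]
        positivity

lemma exists_pow_div_Gamma_le {θ c : ℝ} (hθ : 0 < θ) (hc : 1 ≤ c) {A : ℝ} (hA : 0 ≤ A) :
    ∃ C, 0 ≤ C ∧ ∀ n : ℕ, A ^ n / Real.Gamma ((n : ℝ) * θ + c) ≤ C * (1 / 2) ^ n := by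
  set B : ℝ := (2 * A + 1) ^ θ⁻¹ with hBdef
  have hA1 : 0 < 2 * A + 1 := by positivity
  have hB : 0 < B := by positivity
  have hBθ : B ^ θ = 2 * A + 1 := by
    rw [hBdef, ← Real.rpow_mul hA1.le, inv_mul_cancel₀ hθ.ne', Real.rpow_one]
  refine ⟨Real.exp B / B ^ (c - 1), by positivity, fun n => ?_⟩
  have hn : (0 : ℝ) ≤ n * θ := by positivity
  have hG := rpow_mul_exp_neg_le_Gamma (x := n * θ + c) (by linarith) hB
  have hpow : B ^ ((n : ℝ) * θ + c - 1) = (2 * A + 1) ^ n * B ^ (c - 1) := by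
    rw [add_sub_assoc, Real.rpow_add hB, mul_comm (n : ℝ), Real.rpow_mul hB.le, hBθ,
      Real.rpow_natCast]
  rw [hpow] at hG
  have hpos : 0 < (2 * A + 1) ^ n * B ^ (c - 1) * Real.exp (-B) := by positivity
  calc A ^ n / Real.Gamma ((n : ℝ) * θ + c)
      ≤ A ^ n / ((2 * A + 1) ^ n * B ^ (c - 1) * Real.exp (-B)) := by gcongr
    _ = Real.exp B / B ^ (c - 1) * (A / (2 * A + 1)) ^ n := by
        rw [Real.exp_neg, div_pow]
        field_simp
    _ ≤ Real.exp B / B ^ (c - 1) * (1 / 2) ^ n := by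
        have : A / (2 * A + 1) ≤ 1 / 2 := by
          rw [div_le_div_iff₀ hA1 two_pos]; linarith
        gcongr

lemma integral_sub_rpow_mul_sub_rpow {a b r t : ℝ} (ha : 0 < a) (hb : 0 < b) (hrt : r < t) :
    ∫ s in r..t, (t - s) ^ (a - 1) * (s - r) ^ (b - 1) =
      ProbabilityTheory.beta a b * (t - r) ^ (a + b - 1) := by
  have hd : 0 < t - r := sub_pos.2 hrt
  have h1 : ∫ s in r..t, (t - s) ^ (a - 1) * (s - r) ^ (b - 1) =
      ∫ x in (0 : ℝ)..(t - r), x ^ (a - 1) * (t - r - x) ^ (b - 1) := by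
    have h := intervalIntegral.integral_comp_sub_left (a := r) (b := t)
      (fun x => x ^ (a - 1) * (t - r - x) ^ (b - 1)) t
    rw [sub_self] at h
    rw [← h]
    refine intervalIntegral.integral_congr fun x _ => ?_
    congr 2
    ring
  have h2 := Complex.betaIntegral_scaled a b hd
  rw [h1, ProbabilityTheory.beta_eq_betaIntegralReal a b ha hb]
  have h3 : ∫ x in (0 : ℝ)..(t - r), (x : ℂ) ^ ((a : ℂ) - 1) * (((t - r : ℝ) : ℂ) - x) ^ ((b : ℂ) - 1)
      = ((∫ x in (0 : ℝ)..(t - r), x ^ (a - 1) * (t - r - x) ^ (b - 1) : ℝ) : ℂ) := by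
    rw [← intervalIntegral.integral_ofReal]
    refine intervalIntegral.integral_congr fun x hx => ?_
    rw [uIcc_of_le hd.le] at hx
    rw [Complex.ofReal_mul, Complex.ofReal_cpow hx.1, Complex.ofReal_cpow (sub_nonneg.2 hx.2)]
    push_cast
    rfl
  rw [h3] at h2
  have h4 := congrArg Complex.re h2
  rw [Complex.ofReal_re] at h4
  rw [h4, show (a : ℂ) + b - 1 = ((a + b - 1 : ℝ) : ℂ) by push_cast; rfl,
    ← Complex.ofReal_cpow hd.le, Complex.re_ofReal_mul, mul_comm]

lemma intervalIntegrable_sub_rpow {a : ℝ} (ha : 0 < a) (t₀ u : ℝ) :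
    IntervalIntegrable (fun s => (u - s) ^ (a - 1)) volume t₀ u := by
  have h := (intervalIntegral.intervalIntegrable_rpow' (a := u - t₀) (b := 0) (r := a - 1)
    (by linarith)).comp_sub_left u
  simpa using h

lemma integral_sub_rpow {a : ℝ} (ha : 0 < a) (t₀ u : ℝ) :
    ∫ s in t₀..u, (u - s) ^ (a - 1) = (u - t₀) ^ a / a := by
  rw [intervalIntegral.integral_comp_sub_left (fun x => x ^ (a - 1)) u,
    integral_rpow (Or.inl (by linarith))]
  simp [ha.ne']

lemma intervalIntegrable_sub_rpow_mul {a : ℝ} (ha : 0 < a) (t₀ u : ℝ) {g : ℝ → ℝ}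
    (hg : Continuous g) :
    IntervalIntegrable (fun s => (u - s) ^ (a - 1) * g s) volume t₀ u :=
  (intervalIntegrable_sub_rpow ha t₀ u).mul_continuousOn hg.continuousOn

lemma integral_abs_sub_rpow_mul_le {a M t₀ u : ℝ} (ha : 0 < a) (hu : t₀ ≤ u) {g : ℝ → ℝ}
    (hg : Continuous g) (hM : ∀ s ∈ Icc t₀ u, |g s| ≤ M) :
    ∫ s in t₀..u, |(u - s) ^ (a - 1) * g s| ≤ M * ((u - t₀) ^ a / a) := by
  rw [← integral_sub_rpow ha, mul_comm M, ← intervalIntegral.integral_mul_const]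
  refine intervalIntegral.integral_mono_on hu
    (intervalIntegrable_sub_rpow_mul ha t₀ u hg).norm
    ((intervalIntegrable_sub_rpow ha t₀ u).mul_const M) fun s hs => ?_
  have h0 : 0 ≤ (u - s) ^ (a - 1) := Real.rpow_nonneg (sub_nonneg.2 hs.2) _
  rw [abs_mul, abs_of_nonneg h0]
  gcongr
  exact hM s hs

lemma abs_rlIntegral_le {a M t₀ u : ℝ} (ha : 0 < a) (hu : t₀ ≤ u) {g : ℝ → ℝ}
    (hg : Continuous g) (hM : ∀ s ∈ Icc t₀ u, |g s| ≤ M) :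
    |rlIntegral t₀ a g u| ≤ M * ((u - t₀) ^ a / a) :=
  (intervalIntegral.abs_integral_le_integral_abs hu).trans
    (integral_abs_sub_rpow_mul_le ha hu hg hM)

/-- The iterated kernel of two fractional integrals, extended by zero off the triangle `r < s`. -/
noncomputable def iteratedKernel (a b t : ℝ) (g : ℝ → ℝ) (p : ℝ × ℝ) : ℝ :=
  if p.2 < p.1 then (t - p.1) ^ (a - 1) * ((p.1 - p.2) ^ (b - 1) * g p.2) else 0

lemma setIntegral_Iio_indicator {t₀ s t : ℝ} (hs : s ∈ Ioc t₀ t) (F : ℝ → ℝ) :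
    ∫ r in Ioc t₀ t, (if r < s then F r else 0) = ∫ r in t₀..s, F r := by
  have h : (fun r => if r < s then F r else 0) = (Iio s).indicator F := by
    ext r; simp [indicator_apply]
  have h2 : Ioc t₀ t ∩ Iio s = Ioo t₀ s := by
    ext r
    simp only [mem_inter_iff, mem_Ioc, mem_Iio, mem_Ioo]
    exact ⟨fun h => ⟨h.1.1, h.2⟩, fun h => ⟨⟨h.1, h.2.le.trans hs.2⟩, h.2⟩⟩
  rw [h, setIntegral_indicator measurableSet_Iio, h2, intervalIntegral.integral_of_le hs.1.le,
    integral_Ioc_eq_integral_Ioo]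

lemma setIntegral_Ioi_indicator {t₀ r t : ℝ} (hr : r ∈ Ioc t₀ t) (F : ℝ → ℝ) :
    ∫ s in Ioc t₀ t, (if r < s then F s else 0) = ∫ s in r..t, F s := by
  have h : (fun s => if r < s then F s else 0) = (Ioi r).indicator F := by
    ext s; simp [indicator_apply]
  have h2 : Ioc t₀ t ∩ Ioi r = Ioc r t := by
    ext s
    simp only [mem_inter_iff, mem_Ioc, mem_Ioi]
    exact ⟨fun h => ⟨h.2, h.1.2⟩, fun h => ⟨⟨hr.1.trans h.1, h.2⟩, h.1⟩⟩
  rw [h, setIntegral_indicator measurableSet_Ioi, h2, intervalIntegral.integral_of_le hr.2]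

lemma measurable_iteratedKernel (a b t : ℝ) {g : ℝ → ℝ} (hg : Continuous g) :
    Measurable (iteratedKernel a b t g) := by
  have hgm := hg.measurable
  refine Measurable.ite (measurableSet_lt measurable_snd measurable_fst) ?_ measurable_const
  fun_prop

lemma integral_iteratedKernel_left {a b t₀ s t : ℝ} {g : ℝ → ℝ} (hs : s ∈ Ioc t₀ t) :
    ∫ r in Ioc t₀ t, iteratedKernel a b t g (s, r) =
      (t - s) ^ (a - 1) * rlIntegral t₀ b g s := by
  rw [rlIntegral, ← intervalIntegral.integral_const_mul]
  exact setIntegral_Iio_indicator hs _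

lemma integrable_iteratedKernel {a b t₀ t : ℝ} (ha : 0 < a) (hb : 0 < b) (ht : t₀ ≤ t)
    {g : ℝ → ℝ} (hg : Continuous g) :
    Integrable (iteratedKernel a b t g)
      ((volume.restrict (Ioc t₀ t)).prod (volume.restrict (Ioc t₀ t))) := by
  obtain ⟨M, hM⟩ := isCompact_Icc.exists_bound_of_continuousOn (s := Icc t₀ t) hg.continuousOn
  have hM0 : 0 ≤ M := (norm_nonneg _).trans (hM t₀ ⟨le_rfl, ht⟩)
  have hmeas := measurable_iteratedKernel a b t hg
  rw [integrable_prod_iff hmeas.aestronglyMeasurable]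
  constructor
  · filter_upwards [ae_restrict_mem measurableSet_Ioc] with s hs
    have h1 : IntegrableOn (fun r => (t - s) ^ (a - 1) * ((s - r) ^ (b - 1) * g r))
        (Ioo t₀ s) := by
      have := (intervalIntegrable_sub_rpow_mul hb t₀ s hg).1.mono_set Ioo_subset_Ioc_self
      exact this.const_mul _
    have h2 : IntegrableOn (fun r => iteratedKernel a b t g (s, r)) (Iio s ∩ Ioc t₀ t) := by
      refine (h1.mono_set (t := Ioo t₀ s) fun r hr => ⟨hr.2.1, hr.1⟩).congr_fun ?_
        (measurableSet_Iio.inter measurableSet_Ioc)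
      intro r hr
      have : r < s := hr.1
      simp [iteratedKernel, this]
    have h3 : (fun r => iteratedKernel a b t g (s, r)) =
        (Iio s).indicator (fun r => iteratedKernel a b t g (s, r)) := by
      ext r
      by_cases hr : r < s <;> simp [iteratedKernel, hr]
    rw [h3, integrable_indicator_iff measurableSet_Iio, IntegrableOn,
      Measure.restrict_restrict measurableSet_Iio]
    exact h2
  · have hint : Integrable (fun s => (t - s) ^ (a - 1) * (M * ((t - t₀) ^ b / b)))
        (volume.restrict (Ioc t₀ t)) :=
      (intervalIntegrable_sub_rpow ha t₀ t).1.mul_const _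
    refine hint.mono' hmeas.aestronglyMeasurable.norm.integral_prod_right' ?_
    filter_upwards [ae_restrict_mem measurableSet_Ioc] with s hs
    have h0 : 0 ≤ (t - s) ^ (a - 1) := Real.rpow_nonneg (sub_nonneg.2 hs.2) _
    have h1 : ∫ r in Ioc t₀ t, ‖iteratedKernel a b t g (s, r)‖ =
        (t - s) ^ (a - 1) * ∫ r in t₀..s, |(s - r) ^ (b - 1) * g r| := by
      rw [← intervalIntegral.integral_const_mul, ← setIntegral_Iio_indicator hs]
      congr 1 with r
      by_cases hr : r < s
      · simp [iteratedKernel, hr, abs_mul, abs_of_nonneg h0]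
      · simp [iteratedKernel, hr]
    rw [Real.norm_of_nonneg (integral_nonneg fun _ => norm_nonneg _), h1]
    have h2 := integral_abs_sub_rpow_mul_le hb hs.1.le hg
      (fun r hr => hM r ⟨hr.1, hr.2.trans hs.2⟩)
    have h3 : 0 ≤ s - t₀ := sub_nonneg.2 hs.1.le
    refine mul_le_mul_of_nonneg_left (h2.trans ?_) h0
    gcongr
    exact hs.2

lemma intervalIntegrable_sub_rpow_mul_rlIntegral {a b t₀ t : ℝ} (ha : 0 < a) (hb : 0 < b)
    (ht : t₀ ≤ t) {g : ℝ → ℝ} (hg : Continuous g) :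
    IntervalIntegrable (fun s => (t - s) ^ (a - 1) * rlIntegral t₀ b g s) volume t₀ t := by
  rw [intervalIntegrable_iff_integrableOn_Ioc_of_le ht]
  refine (integrable_iteratedKernel ha hb ht hg).integral_prod_left.congr ?_
  filter_upwards [ae_restrict_mem measurableSet_Ioc] with s hs
  exact integral_iteratedKernel_left hs

/-- The semigroup property of Riemann–Liouville integrals. -/
lemma rlIntegral_rlIntegral {a b t₀ t : ℝ} (ha : 0 < a) (hb : 0 < b) (ht : t₀ ≤ t)
    {g : ℝ → ℝ} (hg : Continuous g) :
    rlIntegral t₀ a (rlIntegral t₀ b g) t =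
      ProbabilityTheory.beta a b * rlIntegral t₀ (a + b) g t := by
  have h1 : rlIntegral t₀ a (rlIntegral t₀ b g) t =
      ∫ s in Ioc t₀ t, ∫ r in Ioc t₀ t, iteratedKernel a b t g (s, r) := by
    rw [rlIntegral, intervalIntegral.integral_of_le ht]
    exact setIntegral_congr_fun measurableSet_Ioc fun s hs => (integral_iteratedKernel_left hs).symm
  rw [h1, integral_integral_swap (f := fun s r => iteratedKernel a b t g (s, r))
    (integrable_iteratedKernel ha hb ht hg), rlIntegral, ← intervalIntegral.integral_const_mul,
    intervalIntegral.integral_of_le ht, integral_Ioc_eq_integral_Ioo,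
    integral_Ioc_eq_integral_Ioo]
  refine setIntegral_congr_fun measurableSet_Ioo fun r hr => ?_
  have h2 := integral_sub_rpow_mul_sub_rpow ha hb hr.2
  have h3 := setIntegral_Ioi_indicator (t := t) (Ioo_subset_Ioc_self hr)
    (fun s => (t - s) ^ (a - 1) * ((s - r) ^ (b - 1) * g r))
  simp only [← mul_assoc, intervalIntegral.integral_mul_const, h2] at h3
  simp only [iteratedKernel, ← mul_assoc]
  exact h3

lemma exists_abs_genBinom_mul_rpow_le (r : ℝ) {θ c p S : ℝ} (hθ : 0 < θ) (hc : 0 < c)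
    (hp : 0 ≤ p) (hS : 0 ≤ S) :
    ∃ C, ∀ k : ℕ, |genBinom r k * p ^ k / Real.Gamma ((k : ℝ) * θ + c)| *
      (S ^ ((k : ℝ) * θ + c) / ((k : ℝ) * θ + c)) ≤ C * (1 / 2) ^ k := by
  obtain ⟨C, hC0, hC⟩ := exists_pow_div_Gamma_le hθ (c := c + 1) (by linarith)
    (A := (|r| + 1) * p * S ^ θ) (by positivity)
  refine ⟨C * S ^ c, fun k => ?_⟩
  have hk : 0 < (k : ℝ) * θ + c := by positivity
  have hG := Real.Gamma_pos_of_pos hk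
  have hG1 : Real.Gamma ((k : ℝ) * θ + (c + 1)) =
      ((k : ℝ) * θ + c) * Real.Gamma ((k : ℝ) * θ + c) := by
    rw [← add_assoc, Real.Gamma_add_one hk.ne']
  have hpow : S ^ ((k : ℝ) * θ + c) = (S ^ θ) ^ k * S ^ c := by
    rw [Real.rpow_add_of_nonneg hS (by positivity) hc.le, mul_comm (k : ℝ), Real.rpow_mul hS,
      Real.rpow_natCast]
  have h := hC k
  rw [hG1] at h
  rw [abs_div, abs_mul, abs_of_pos hG, abs_of_nonneg (pow_nonneg hp k), hpow]
  calc |genBinom r k| * p ^ k / Real.Gamma ((k : ℝ) * θ + c) *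
        ((S ^ θ) ^ k * S ^ c / ((k : ℝ) * θ + c))
      ≤ (|r| + 1) ^ k * p ^ k / Real.Gamma ((k : ℝ) * θ + c) *
        ((S ^ θ) ^ k * S ^ c / ((k : ℝ) * θ + c)) := by
        gcongr
        exact abs_genBinom_le r k
    _ = ((|r| + 1) * p * S ^ θ) ^ k /
          (((k : ℝ) * θ + c) * Real.Gamma ((k : ℝ) * θ + c)) * S ^ c := by
        rw [mul_pow, mul_pow]
        field_simp
    _ ≤ C * (1 / 2) ^ k * S ^ c := by gcongr
    _ = C * S ^ c * (1 / 2) ^ k := by ring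

lemma hasSum_intervalIntegral_of_summable_bound {t₀ t : ℝ} (ht : t₀ ≤ t) {F : ℕ → ℝ → ℝ}
    {B : ℕ → ℝ} (hF : ∀ k, IntervalIntegrable (F k) volume t₀ t)
    (hB : ∀ k, ∫ s in t₀..t, |F k s| ≤ B k) (hsum : Summable B) :
    HasSum (fun k => ∫ s in t₀..t, F k s) (∫ s in t₀..t, ∑' k, F k s) := by
  simp only [intervalIntegral.integral_of_le ht] at hB ⊢
  refine hasSum_integral_of_summable_integral_norm (fun k => (hF k).1) ?_
  exact Summable.of_nonneg_of_le (fun k => integral_nonneg fun _ => norm_nonneg _) hB hsum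

lemma mittagLeffler_neg_eq_tsum (θ μ γ p z : ℝ) :
    mittagLeffler θ μ γ (-p) z =
      ∑' k : ℕ, genBinom (-γ) k * p ^ k / Real.Gamma ((k : ℝ) * θ + μ) *
        z ^ ((k : ℝ) * θ + μ - 1) := by
  refine tsum_congr fun k => ?_
  calc (-p) ^ k * z ^ ((k : ℝ) * θ + μ - 1) * risingFac γ k /
        (Real.Gamma ((k : ℝ) * θ + μ) * (k.factorial : ℝ))
      = (-p) ^ k * (risingFac γ k / (k.factorial : ℝ)) / Real.Gamma ((k : ℝ) * θ + μ) *
        z ^ ((k : ℝ) * θ + μ - 1) := by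
        have := Nat.factorial_ne_zero k
        field_simp
    _ = _ := by
        rw [risingFac_div_factorial, ← mul_assoc, ← mul_pow]
        ring_nf

lemma hasSum_integral_mittagLeffler (γ : ℝ) {θ μ p t₀ u : ℝ} (hθ : 0 < θ) (hμ : 0 < μ)
    (hp : 0 ≤ p) (hu : t₀ ≤ u) {g : ℝ → ℝ} (hg : Continuous g) :
    HasSum (fun k : ℕ => genBinom (-γ) k * p ^ k / Real.Gamma ((k : ℝ) * θ + μ) *
        rlIntegral t₀ ((k : ℝ) * θ + μ) g u)
      (∫ s in t₀..u, mittagLeffler θ μ γ (-p) (u - s) * g s) := by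
  obtain ⟨M, hM⟩ := isCompact_Icc.exists_bound_of_continuousOn (s := Icc t₀ u) hg.continuousOn
  obtain ⟨C, hC⟩ := exists_abs_genBinom_mul_rpow_le (-γ) hθ hμ hp (sub_nonneg.2 hu)
  have hM0 : 0 ≤ M := (norm_nonneg _).trans (hM t₀ ⟨le_rfl, hu⟩)
  simp only [mittagLeffler_neg_eq_tsum, rlIntegral, ← tsum_mul_right, mul_assoc,
    ← intervalIntegral.integral_const_mul]
  refine hasSum_intervalIntegral_of_summable_bound hu (B := fun k => M * (C * (1 / 2) ^ k))
    (fun k => ?_) (fun k => ?_) ((summable_geometric_two.mul_left C).mul_left M)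
  · exact (intervalIntegrable_sub_rpow_mul (by positivity) t₀ u hg).const_mul _
  · have h1 := integral_abs_sub_rpow_mul_le (a := (k : ℝ) * θ + μ) (by positivity) hu hg hM
    simp only [abs_mul _ (_ * _), intervalIntegral.integral_const_mul]
    calc _ ≤ |genBinom (-γ) k * p ^ k / Real.Gamma ((k : ℝ) * θ + μ)| *
          (M * ((u - t₀) ^ ((k : ℝ) * θ + μ) / ((k : ℝ) * θ + μ))) :=
          mul_le_mul_of_nonneg_left h1 (abs_nonneg _)
      _ = M * (|genBinom (-γ) k * p ^ k / Real.Gamma ((k : ℝ) * θ + μ)| *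
          ((u - t₀) ^ ((k : ℝ) * θ + μ) / ((k : ℝ) * θ + μ))) := by ring
      _ ≤ _ := mul_le_mul_of_nonneg_left (hC k) hM0

lemma hasSum_rlIntegral_integral_mittagLeffler (γ : ℝ) {a θ μ p t₀ t : ℝ} (ha : 0 < a)
    (hθ : 0 < θ) (hμ : 0 < μ) (hp : 0 ≤ p) (ht : t₀ ≤ t) {g : ℝ → ℝ} (hg : Continuous g) :
    HasSum (fun k : ℕ => genBinom (-γ) k * p ^ k / Real.Gamma ((k : ℝ) * θ + μ) *
        (ProbabilityTheory.beta a ((k : ℝ) * θ + μ) * rlIntegral t₀ (a + ((k : ℝ) * θ + μ)) g t))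
      (rlIntegral t₀ a (fun u => ∫ s in t₀..u, mittagLeffler θ μ γ (-p) (u - s) * g s) t) := by
  obtain ⟨M, hM⟩ := isCompact_Icc.exists_bound_of_continuousOn (s := Icc t₀ t) hg.continuousOn
  obtain ⟨C, hC⟩ := exists_abs_genBinom_mul_rpow_le (-γ) hθ hμ hp (sub_nonneg.2 ht)
  have hM0 : 0 ≤ M := (norm_nonneg _).trans (hM t₀ ⟨le_rfl, ht⟩)
  set c : ℕ → ℝ := fun k => genBinom (-γ) k * p ^ k / Real.Gamma ((k : ℝ) * θ + μ) with hc
  have hk0 : ∀ k : ℕ, 0 < (k : ℝ) * θ + μ := fun k => by positivity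
  have h1 : rlIntegral t₀ a (fun u => ∫ s in t₀..u, mittagLeffler θ μ γ (-p) (u - s) * g s) t =
      ∫ s in t₀..t, ∑' k, c k * ((t - s) ^ (a - 1) * rlIntegral t₀ ((k : ℝ) * θ + μ) g s) := by
    refine intervalIntegral.integral_congr fun s hs => ?_
    rw [uIcc_of_le ht] at hs
    simp only [← (hasSum_integral_mittagLeffler γ hθ hμ hp hs.1 hg).tsum_eq, ← tsum_mul_left]
    exact tsum_congr fun k => by ring
  have h2 : ∀ k : ℕ, c k * (ProbabilityTheory.beta a ((k : ℝ) * θ + μ) *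
      rlIntegral t₀ (a + ((k : ℝ) * θ + μ)) g t) =
      ∫ s in t₀..t, c k * ((t - s) ^ (a - 1) * rlIntegral t₀ ((k : ℝ) * θ + μ) g s) := fun k => by
    rw [intervalIntegral.integral_const_mul, ← rlIntegral_rlIntegral ha (hk0 k) ht hg, rlIntegral]
  rw [h1, funext h2]
  refine hasSum_intervalIntegral_of_summable_bound ht
    (B := fun k => (t - t₀) ^ a / a * M * (C * (1 / 2) ^ k))
    (fun k => (intervalIntegrable_sub_rpow_mul_rlIntegral ha (hk0 k) ht hg).const_mul _)
    (fun k => ?_) ((summable_geometric_two.mul_left C).mul_left _)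
  have h3 : ∫ s in t₀..t, |c k * ((t - s) ^ (a - 1) * rlIntegral t₀ ((k : ℝ) * θ + μ) g s)| ≤
      ∫ s in t₀..t, (t - s) ^ (a - 1) *
        (|c k| * (M * ((t - t₀) ^ ((k : ℝ) * θ + μ) / ((k : ℝ) * θ + μ)))) := by
    refine intervalIntegral.integral_mono_on ht
      ((intervalIntegrable_sub_rpow_mul_rlIntegral ha (hk0 k) ht hg).const_mul _).norm
      ((intervalIntegrable_sub_rpow ha t₀ t).mul_const _) fun s hs => ?_
    have h0 : 0 ≤ (t - s) ^ (a - 1) := Real.rpow_nonneg (sub_nonneg.2 hs.2) _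
    have h4 := abs_rlIntegral_le (hk0 k) hs.1 hg fun r hr => hM r ⟨hr.1, hr.2.trans hs.2⟩
    have h5 : (s - t₀) ^ ((k : ℝ) * θ + μ) ≤ (t - t₀) ^ ((k : ℝ) * θ + μ) :=
      Real.rpow_le_rpow (sub_nonneg.2 hs.1) (by linarith [hs.2]) (hk0 k).le
    rw [abs_mul, abs_mul, abs_of_nonneg h0, mul_left_comm]
    refine mul_le_mul_of_nonneg_left (mul_le_mul_of_nonneg_left (h4.trans ?_) (abs_nonneg _)) h0
    have := hk0 k
    gcongr
  refine h3.trans ?_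
  rw [intervalIntegral.integral_mul_const, integral_sub_rpow ha]
  have h6 : 0 ≤ (t - t₀) ^ a / a := div_nonneg (Real.rpow_nonneg (sub_nonneg.2 ht) _) ha.le
  calc _ = (t - t₀) ^ a / a * M *
        (|c k| * ((t - t₀) ^ ((k : ℝ) * θ + μ) / ((k : ℝ) * θ + μ))) := by ring
    _ ≤ _ := mul_le_mul_of_nonneg_left (hC k) (mul_nonneg h6 hM0)

lemma summable_genBinom_mul_rlIntegral (r q : ℝ) {θ p t₀ t : ℝ} (hθ : 0 < θ) (hp : 0 ≤ p)
    (ht : t₀ ≤ t) {g : ℝ → ℝ} (hg : Continuous g) :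
    Summable fun ik : ℕ × ℕ => genBinom r ik.1 * genBinom q ik.2 *
      (p ^ (ik.1 + ik.2) / Real.Gamma (((ik.1 + ik.2 : ℕ) : ℝ) * θ + 1) *
        rlIntegral t₀ (((ik.1 + ik.2 : ℕ) : ℝ) * θ + 1) g t) := by
  obtain ⟨M, hM⟩ := isCompact_Icc.exists_bound_of_continuousOn (s := Icc t₀ t) hg.continuousOn
  have hM0 : 0 ≤ M := (norm_nonneg _).trans (hM t₀ ⟨le_rfl, ht⟩)
  have hS : 0 ≤ t - t₀ := sub_nonneg.2 ht
  set K : ℝ := max (|r| + 1) (|q| + 1) with hK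
  have hK0 : 0 ≤ K := le_max_of_le_left (by positivity)
  obtain ⟨C, hC0, hC⟩ := exists_pow_div_Gamma_le hθ (c := 2) (by norm_num)
    (A := K * p * (t - t₀) ^ θ) (by positivity)
  have hgeo : Summable fun ik : ℕ × ℕ => M * (t - t₀) * C * ((1 / 2 : ℝ) ^ ik.1 * (1 / 2) ^ ik.2) :=
    (summable_geometric_two.mul_of_nonneg summable_geometric_two (fun _ => by positivity)
      fun _ => by positivity).mul_left _
  refine Summable.of_norm_bounded hgeo ?_
  rintro ⟨i, k⟩
  rw [← pow_add]
  set n := i + k with hn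
  have hn0 : 0 < (n : ℝ) * θ + 1 := by positivity
  have hG := Real.Gamma_pos_of_pos hn0
  have hG2 : Real.Gamma ((n : ℝ) * θ + 2) =
      ((n : ℝ) * θ + 1) * Real.Gamma ((n : ℝ) * θ + 1) := by
    rw [← Real.Gamma_add_one hn0.ne']
    ring_nf
  have hbin : |genBinom r i * genBinom q k| ≤ K ^ n := by
    rw [abs_mul, hn, pow_add]
    refine mul_le_mul ((abs_genBinom_le r i).trans ?_) ((abs_genBinom_le q k).trans ?_)
      (abs_nonneg _) (by positivity)
    · exact pow_le_pow_left₀ (by positivity) (le_max_left _ _) _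
    · exact pow_le_pow_left₀ (by positivity) (le_max_right _ _) _
  have hpow : (t - t₀) ^ ((n : ℝ) * θ + 1) = ((t - t₀) ^ θ) ^ n * (t - t₀) := by
    rw [Real.rpow_add_of_nonneg hS (by positivity) zero_le_one, mul_comm (n : ℝ),
      Real.rpow_mul hS, Real.rpow_natCast, Real.rpow_one]
  have hrl := abs_rlIntegral_le hn0 ht hg hM
  rw [hpow] at hrl
  have hC' := hC n
  rw [hG2] at hC'
  rw [Real.norm_eq_abs, abs_mul, abs_mul (_ / _), abs_div, abs_of_pos hG,
    abs_of_nonneg (pow_nonneg hp n)]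
  calc _ ≤ K ^ n * (p ^ n / Real.Gamma ((n : ℝ) * θ + 1) *
        (M * (((t - t₀) ^ θ) ^ n * (t - t₀) / ((n : ℝ) * θ + 1)))) := by gcongr
    _ = M * (t - t₀) * ((K * p * (t - t₀) ^ θ) ^ n /
        (((n : ℝ) * θ + 1) * Real.Gamma ((n : ℝ) * θ + 1))) := by
        rw [mul_pow, mul_pow]
        field_simp
    _ ≤ M * (t - t₀) * (C * (1 / 2) ^ n) := by gcongr
    _ = _ := by ring

lemma tsum_tsum_genBinom_mul_rlIntegral (r : ℝ) {θ p t₀ t : ℝ} (hθ : 0 < θ) (hp : 0 ≤ p)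
    (ht : t₀ ≤ t) {g : ℝ → ℝ} (hg : Continuous g) :
    ∑' (i : ℕ) (k : ℕ), genBinom r i * genBinom (-r) k *
      (p ^ (i + k) / Real.Gamma (((i + k : ℕ) : ℝ) * θ + 1) *
        rlIntegral t₀ (((i + k : ℕ) : ℝ) * θ + 1) g t) = ∫ s in t₀..t, g s := by
  have hsum := summable_genBinom_mul_rlIntegral r (-r) hθ hp ht hg
  rw [← hsum.tsum_prod (f := fun ik : ℕ × ℕ => genBinom r ik.1 * genBinom (-r) ik.2 *
      (p ^ (ik.1 + ik.2) / Real.Gamma (((ik.1 + ik.2 : ℕ) : ℝ) * θ + 1) *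
        rlIntegral t₀ (((ik.1 + ik.2 : ℕ) : ℝ) * θ + 1) g t)),
    ← Finset.HasAntidiagonal.sigmaAntidiagonalEquivProd.tsum_eq]
  refine (Finset.HasAntidiagonal.sigmaAntidiagonalEquivProd.summable_iff.2 hsum).tsum_sigma.trans ?_
  have h : ∀ n : ℕ, ∑' x : Finset.HasAntidiagonal.antidiagonal n,
      (genBinom r (x : ℕ × ℕ).1 * genBinom (-r) (x : ℕ × ℕ).2 *
        (p ^ ((x : ℕ × ℕ).1 + (x : ℕ × ℕ).2) /
          Real.Gamma ((((x : ℕ × ℕ).1 + (x : ℕ × ℕ).2 : ℕ) : ℝ) * θ + 1) *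
        rlIntegral t₀ ((((x : ℕ × ℕ).1 + (x : ℕ × ℕ).2 : ℕ) : ℝ) * θ + 1) g t)) =
      if n = 0 then ∫ s in t₀..t, g s else 0 := fun n => by
    rw [tsum_fintype, Finset.sum_coe_sort (Finset.HasAntidiagonal.antidiagonal n)
      (fun x : ℕ × ℕ => genBinom r x.1 * genBinom (-r) x.2 *
        (p ^ (x.1 + x.2) / Real.Gamma (((x.1 + x.2 : ℕ) : ℝ) * θ + 1) *
        rlIntegral t₀ (((x.1 + x.2 : ℕ) : ℝ) * θ + 1) g t))]
    have h1 : ∀ x ∈ Finset.HasAntidiagonal.antidiagonal n,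
        genBinom r x.1 * genBinom (-r) x.2 *
        (p ^ (x.1 + x.2) / Real.Gamma (((x.1 + x.2 : ℕ) : ℝ) * θ + 1) *
        rlIntegral t₀ (((x.1 + x.2 : ℕ) : ℝ) * θ + 1) g t) =
        genBinom r x.1 * genBinom (-r) x.2 * (p ^ n / Real.Gamma ((n : ℝ) * θ + 1) *
        rlIntegral t₀ ((n : ℝ) * θ + 1) g t) := fun x hx => by
      rw [Finset.HasAntidiagonal.mem_antidiagonal.1 hx]
    rw [Finset.sum_congr rfl h1, ← Finset.sum_mul, sum_antidiagonal_genBinom_mul_neg]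
    split_ifs with hn
    · subst hn
      simp [rlIntegral]
    · simp
  exact (tsum_congr h).trans (tsum_ite_eq 0 _)

/-- The AB integral inverts the ABC derivative up to the initial value. -/
theorem ab_integral_abc_deriv
    (t0 T θ μ γ b : ℝ) (htT : t0 < T) (hθ0 : 0 < θ) (hθ1 : θ < 1)
    (hμ0 : 0 < μ) (hμ1 : μ < 1) (hγ : 0 < γ) (hb : 0 < b)
    (η : ℝ → ℝ) (hη : ContDiff ℝ 1 η) :
    ∀ t ∈ Set.Icc t0 T,
      ABIntegral t0 b θ μ γ (fun u => ABCDeriv t0 b θ μ γ η u) t = η t - η t0 := by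
  intro t ht
  have hg : Continuous (deriv η) := hη.continuous_deriv le_rfl
  have hθ' : 0 < 1 - θ := sub_pos.2 hθ1
  set p : ℝ := θ / (1 - θ) with hpdef
  have hp : 0 ≤ p := by positivity
  have hend : ∫ s in t0..t, deriv η s = η t - η t0 :=
    intervalIntegral.integral_deriv_eq_sub (fun x _ => hη.differentiable one_ne_zero x)
      (hg.intervalIntegrable _ _)
  rw [← hend, ← tsum_tsum_genBinom_mul_rlIntegral γ hθ0 hp ht.1 hg, ABIntegral]
  refine tsum_congr fun i => ?_
  have ha : 0 < (i : ℝ) * θ + 1 - μ := by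
    have : 0 ≤ (i : ℝ) * θ := by positivity
    linarith
  have hGa := Real.Gamma_pos_of_pos ha
  have hint : ∫ s in t0..t, (t - s) ^ ((i : ℝ) * θ - μ) * ABCDeriv t0 b θ μ γ η s =
      b / (1 - θ) * rlIntegral t0 ((i : ℝ) * θ + 1 - μ)
        (fun u => ∫ s in t0..u, mittagLeffler θ μ γ (-p) (u - s) * deriv η s) t := by
    rw [rlIntegral, ← intervalIntegral.integral_const_mul]
    refine intervalIntegral.integral_congr fun s _ => ?_
    simp only [ABCDeriv, neg_div, ← hpdef]
    rw [show (i : ℝ) * θ + 1 - μ - 1 = (i : ℝ) * θ - μ by ring]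
    ring
  rw [hint, ← (hasSum_rlIntegral_integral_mittagLeffler γ ha hθ0 hμ0 hp ht.1 hg).tsum_eq,
    ← tsum_mul_left, ← tsum_mul_left]
  refine tsum_congr fun k => ?_
  have hk : 0 < (k : ℝ) * θ + μ := by positivity
  have hGk := Real.Gamma_pos_of_pos hk
  have hidx : (i : ℝ) * θ + 1 - μ + ((k : ℝ) * θ + μ) = ((i + k : ℕ) : ℝ) * θ + 1 := by
    push_cast
    ring
  have hcoef : genBinom γ i * θ ^ i /
      (b * (1 - θ) ^ ((i : ℝ) - 1) * Real.Gamma ((i : ℝ) * θ + 1 - μ)) * (b / (1 - θ)) =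
      genBinom γ i * p ^ i / Real.Gamma ((i : ℝ) * θ + 1 - μ) := by
    rw [Real.rpow_sub_one hθ'.ne', Real.rpow_natCast, hpdef, div_pow]
    field_simp
  rw [← mul_assoc, hcoef, ProbabilityTheory.beta, hidx, pow_add]
  field_simp
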